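/- A countable graph G is co-finite if and only if G is a minor-universal element of some co-finite minor-closed class of countable graphs; in that case one may take the class {H countable : H < G}. -/

import Mathlib

/-- `H` is a minor of `G`: pairwise disjoint nonempty connected branch sets, one for each
vertex of `H`, with a `G`-edge between the branch sets of any two `H`-adjacent vertices. -/
def IsMinor {V : Type*} {W : Type*} (H : SimpleGraph V) (G : SimpleGraph W) : Prop :=
  ∃ B : V → Set W,
    (∀ v : V, (G.induce (B v)).Connected) ∧
    (∀ u v : V, u ≠ v → Disjoint (B u) (B v)) ∧
    (∀ u v : V, H.Adj u v → ∃ x ∈ B u, ∃ y ∈ B v, G.Adj x y)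

/-- A countable graph: a simple graph together with its (countable) vertex type. -/
structure CGraph where
  V : Type
  countable : Countable V
  graph : SimpleGraph V

/-- A class of countable graphs is minor-closed if it contains every countable graph that
is a minor of one of its members. -/
def MinorClosed (C : Set CGraph) : Prop :=
  ∀ G ∈ C, ∀ H : CGraph, IsMinor H.graph G.graph → H ∈ C

/-- `Forb S`: the class of countable graphs having no member of `S` as a minor. -/
def Forb (S : Set CGraph) : Set CGraph :=
  {G : CGraph | ∀ F ∈ S, ¬ IsMinor F.graph G.graph}

/-- A class of countable graphs is co-finite if it equals `Forb S` for some set `S` of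
finite graphs. -/
def CofiniteClass (C : Set CGraph) : Prop :=
  ∃ S : Set CGraph, (∀ F ∈ S, Finite F.V) ∧ C = Forb S

/-- The class of all (countable) minors of `G`. -/
def minorsOf (G : CGraph) : Set CGraph :=
  {H : CGraph | IsMinor H.graph G.graph}

/-- A countable graph `G` is co-finite if the class of its minors is co-finite. -/
def CofiniteGraph (G : CGraph) : Prop := CofiniteClass (minorsOf G)

/-- A union of connected sets indexed by a connected set of `H` is connected, provided that
`H`-adjacent indices give sets joined by an edge. -/
theorem connected_induce_biUnion {V W : Type*} {H : SimpleGraph V} {G : SimpleGraph W}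
    {B : V → Set W} (hB : ∀ v, (G.induce (B v)).Connected)
    (hadj : ∀ u v, H.Adj u v → ∃ x ∈ B u, ∃ y ∈ B v, G.Adj x y)
    {A : Set V} (hA : (H.induce A).Connected) :
    (G.induce (⋃ v ∈ A, B v)).Connected := by
  have hsub : ∀ v ∈ A, B v ⊆ ⋃ v ∈ A, B v := fun v hv => Set.subset_biUnion_of_mem hv
  have within : ∀ (v : A) (x y : W) (hx : x ∈ B v) (hy : y ∈ B v),
      (G.induce (⋃ v ∈ A, B v)).Reachable ⟨x, hsub v v.2 hx⟩ ⟨y, hsub v v.2 hy⟩ :=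
    fun v x y hx hy => ((hB v).preconnected ⟨x, hx⟩ ⟨y, hy⟩).map
      (SimpleGraph.induceHomOfLE G (hsub v v.2)).toHom
  have along : ∀ {u v : A}, (H.induce A).Walk u v → ∀ (x y : W) (hx : x ∈ B u) (hy : y ∈ B v),
      (G.induce (⋃ v ∈ A, B v)).Reachable ⟨x, hsub u u.2 hx⟩ ⟨y, hsub v v.2 hy⟩ := by
    intro u v p
    induction p with
    | nil => exact within _
    | @cons u w v h p ih =>
      intro x y hx hy
      obtain ⟨a, ha, b, hb, hab⟩ := hadj u w h
      have step : (G.induce (⋃ v ∈ A, B v)).Adj ⟨a, hsub u u.2 ha⟩ ⟨b, hsub w w.2 hb⟩ := hab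
      exact (within u x a hx ha).trans (step.reachable.trans (ih b y hb hy))
  obtain ⟨v⟩ := hA.nonempty
  obtain ⟨x, hx⟩ := (hB v).nonempty
  refine (SimpleGraph.connected_iff _).2 ⟨?_, ⟨⟨x, hsub v v.2 hx⟩⟩⟩
  rintro ⟨y, hy⟩ ⟨z, hz⟩
  obtain ⟨u, hu, hyu⟩ := Set.mem_iUnion₂.1 hy
  obtain ⟨w, hw, hzw⟩ := Set.mem_iUnion₂.1 hz
  obtain ⟨p⟩ := hA.preconnected ⟨u, hu⟩ ⟨w, hw⟩
  exact along p y z hyu hzw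

theorem IsMinor.refl {V : Type*} (G : SimpleGraph V) : IsMinor G G := by
  refine ⟨fun v => {v}, fun v => ?_, fun u v h => Set.disjoint_singleton.2 h,
    fun u v h => ⟨u, rfl, v, rfl, h⟩⟩
  exact (SimpleGraph.connected_iff _).2 ⟨SimpleGraph.Preconnected.of_subsingleton, ⟨⟨v, rfl⟩⟩⟩

theorem IsMinor.trans {U V W : Type*} {K : SimpleGraph U} {H : SimpleGraph V}
    {G : SimpleGraph W} (hKH : IsMinor K H) (hHG : IsMinor H G) : IsMinor K G := by
  obtain ⟨A, hAc, hAd, hAe⟩ := hKH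
  obtain ⟨B, hBc, hBd, hBe⟩ := hHG
  refine ⟨fun u => ⋃ v ∈ A u, B v, fun u => connected_induce_biUnion hBc hBe (hAc u), ?_, ?_⟩
  · intro u v huv
    simp only [Set.disjoint_iUnion_left, Set.disjoint_iUnion_right]
    intro x hx y hy
    exact hBd _ _ fun h => Set.disjoint_left.1 (hAd u v huv) hy (h ▸ hx)
  · intro u v huv
    obtain ⟨a, ha, b, hb, hab⟩ := hAe u v huv
    obtain ⟨x, hx, y, hy, hxy⟩ := hBe a b hab
    exact ⟨x, Set.mem_biUnion ha hx, y, Set.mem_biUnion hb hy, hxy⟩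

theorem minorClosed_minorsOf (G : CGraph) : MinorClosed (minorsOf G) :=
  fun _ hH _ hKH => hKH.trans hH

theorem self_mem_minorsOf (G : CGraph) : G ∈ minorsOf G :=
  IsMinor.refl G.graph

/-- A countable graph `G` is co-finite iff `G` is a minor-universal element of some
co-finite minor-closed class of countable graphs; in that case one may take the class
`{H : H < G}` of minors of `G`. -/
theorem cofinite_iff_universal_of_cofinite_class (G : CGraph) :
    (CofiniteGraph G ↔
      ∃ C : Set CGraph, CofiniteClass C ∧ MinorClosed C ∧ G ∈ C ∧
        ∀ H ∈ C, IsMinor H.graph G.graph) ∧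
    (CofiniteGraph G →
      CofiniteClass (minorsOf G) ∧ MinorClosed (minorsOf G) ∧ G ∈ minorsOf G ∧
        ∀ H ∈ minorsOf G, IsMinor H.graph G.graph) := by
  have key : CofiniteGraph G →
      CofiniteClass (minorsOf G) ∧ MinorClosed (minorsOf G) ∧ G ∈ minorsOf G ∧
        ∀ H ∈ minorsOf G, IsMinor H.graph G.graph :=
    fun hG => ⟨hG, minorClosed_minorsOf G, self_mem_minorsOf G, fun _ h => h⟩
  refine ⟨⟨fun hG => ⟨minorsOf G, key hG⟩, ?_⟩, key⟩
  rintro ⟨C, hC, hclosed, hmem, huniv⟩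
  have hCG : C = minorsOf G := Set.Subset.antisymm huniv (hclosed G hmem)
  rwa [hCG] at hC
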